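/- arXiv:2506.04407 — 2 statements merged into one kernel-verified Lean document; each statement's English description precedes it below -/
import Mathlib

section
/- Let k ≥ 4 and let ℓ ∈ ℕ satisfy 2 ≤ ℓ ≤ k−2 or k+2 ≤ ℓ ≤ 2k−2, and set w = ξ^ℓ(0). Suppose x, y ∈ Rext(w) are distinct letters with π(x) = π(y), and u, v ∈ A* are words such that uwx and vwy are factors of u_k and π(u) = π(v) is a prefix of 1^{k−1} or of 0^{k−1}. Then |u| = |v| ≤ k−3. -/
open List Filter Topology

/-- The alphabet `A`: the letter `(b, j)` is the unprimed letter `j` if `b = false`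
and the primed letter `j′` if `b = true`.  Only letters with `j < k` occur. -/
abbrev Letter : Type := Bool × ℕ

/-- The morphism ξ_k on letters: `0 ↦ 01`, `j ↦ j+1` for `1 ≤ j ≤ k−2`, `k−1 ↦ 0′`,
and symmetrically on primed letters with `(k−1)′ ↦ 0`. -/
def xiL (k : ℕ) (a : Letter) : List Letter :=
  if a.2 = 0 then [(a.1, 0), (a.1, 1)]
  else if a.2 = k - 1 then [(!a.1, 0)]
  else [(a.1, a.2 + 1)]

/-- The morphism ξ_k on finite words. -/
def xiW (k : ℕ) (w : List Letter) : List Letter := w.flatMap (xiL k)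

/-- The word ξ_k^n(0). -/
def xiPow (k n : ℕ) : List Letter := (xiW k)^[n] [((false : Bool), (0 : ℕ))]

/-- The projection π : A → {0,1}, with `false` playing the role of `0` and
`true` the role of `1`. -/
def proj (a : Letter) : Bool := if a.2 = 0 then a.1 else !a.1

/-- The twin map `ℓ ↔ ℓ′` on letters. -/
def twin (a : Letter) : Letter := (!a.1, a.2)

/-- The finite word `w` occurs in the infinite word `v` at position `j`. -/
def OccursAt {α : Type*} (w : List α) (v : ℕ → α) (j : ℕ) : Prop :=
  ∀ i, i < w.length → w[i]? = some (v (j + i))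

/-- The finite word `w` is a prefix of the infinite word `v`. -/
def PrefixSeq {α : Type*} (w : List α) (v : ℕ → α) : Prop := OccursAt w v 0

/-- The finite word `w` is a factor of the infinite word `v`. -/
def FactorOf {α : Type*} (w : List α) (v : ℕ → α) : Prop := ∃ j, OccursAt w v j

/-- `v` is the fixed point `u_k = ξ_k^ω(0)`: every `ξ_k^n(0)` is a prefix of `v`. -/
def IsFixedPoint (k : ℕ) (v : ℕ → Letter) : Prop := ∀ n, PrefixSeq (xiPow k n) v

/-- `q ≥ 1` is a period of the finite word `z`. -/
def HasPeriod {α : Type*} (z : List α) (q : ℕ) : Prop :=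
  1 ≤ q ∧ ∀ i, i + q < z.length → z[i]? = z[i + q]?

/-- `w` is a left special factor of the infinite word `v`. -/
def LeftSpecial {α : Type*} (w : List α) (v : ℕ → α) : Prop :=
  ∃ a b : α, a ≠ b ∧ FactorOf (a :: w) v ∧ FactorOf (b :: w) v

/-- `w` is a right special factor of the infinite word `v`. -/
def RightSpecial {α : Type*} (w : List α) (v : ℕ → α) : Prop :=
  ∃ a b : α, a ≠ b ∧ FactorOf (w ++ [a]) v ∧ FactorOf (w ++ [b]) v

/-- `w` is a bispecial factor of the infinite word `v`. -/
def Bispecial {α : Type*} (w : List α) (v : ℕ → α) : Prop :=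
  LeftSpecial w v ∧ RightSpecial w v

/-- The set of left extensions of `w` in `v`. -/
def Lext {α : Type*} (w : List α) (v : ℕ → α) : Set α := {a | FactorOf (a :: w) v}

/-- The set of right extensions of `w` in `v`. -/
def Rext {α : Type*} (w : List α) (v : ℕ → α) : Set α := {a | FactorOf (w ++ [a]) v}

/-- `r` is a return word to `w` in `v`: it spans two consecutive occurrences of `w`. -/
def ReturnWordTo {α : Type*} (r w : List α) (v : ℕ → α) : Prop :=
  ∃ j ℓ, j < ℓ ∧ OccursAt w v j ∧ OccursAt w v ℓ ∧
    (∀ m, j < m → m < ℓ → ¬ OccursAt w v m) ∧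
    r = (List.range (ℓ - j)).map (fun i => v (j + i))

/-- The factor complexity of an infinite word. -/
noncomputable def complexity {α : Type*} (v : ℕ → α) (n : ℕ) : ℕ :=
  {w : List α | w.length = n ∧ FactorOf w v}.ncard

section Occurrences

variable {α : Type*} {v : ℕ → α}

theorem occursAt_nil (j : ℕ) : OccursAt [] v j := by
  intro i hi
  simp at hi

theorem occursAt_cons {a : α} {w : List α} {j : ℕ} :
    OccursAt (a :: w) v j ↔ v j = a ∧ OccursAt w v (j + 1) := by
  constructor
  · intro h
    refine ⟨?_, fun i hi => ?_⟩
    · have := h 0 (by simp)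
      simpa using this.symm
    · have := h (i + 1) (by simpa using hi)
      rw [List.getElem?_cons_succ] at this
      rw [this, show j + (i + 1) = j + 1 + i by omega]
  · rintro ⟨h0, h⟩ i hi
    cases i with
    | zero => simp [h0]
    | succ i =>
      rw [List.getElem?_cons_succ, h i (by simpa using hi), show j + (i + 1) = j + 1 + i by omega]

theorem occursAt_append {w z : List α} {j : ℕ} :
    OccursAt (w ++ z) v j ↔ OccursAt w v j ∧ OccursAt z v (j + w.length) := by
  induction w generalizing j with
  | nil => simp [occursAt_nil]
  | cons a w ih =>
    rw [List.cons_append, occursAt_cons, occursAt_cons, ih, List.length_cons, and_assoc,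
      show j + 1 + w.length = j + (w.length + 1) by omega]

theorem occursAt_singleton {a : α} {j : ℕ} : OccursAt [a] v j ↔ v j = a := by
  simp [occursAt_cons, occursAt_nil]

theorem OccursAt.last {w : List α} {j : ℕ} {a : α} (h : OccursAt w v j)
    (ha : w.getLast? = some a) : 0 < w.length ∧ v (j + w.length - 1) = a := by
  obtain ⟨z, rfl⟩ := List.getLast?_eq_some_iff.1 ha
  have := occursAt_singleton.1 (occursAt_append.1 h).2
  simpa using this

end Occurrences

theorem xiPow_succ (k n : ℕ) : xiPow k (n + 1) = xiW k (xiPow k n) :=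
  Function.iterate_succ_apply' _ _ _

theorem xiW_cons (k : ℕ) (a : Letter) (w : List Letter) :
    xiW k (a :: w) = xiL k a ++ xiW k w := rfl

theorem xiL_zero (k : ℕ) (b : Bool) : xiL k (b, 0) = [(b, 0), (b, 1)] := rfl

theorem xiL_top {k : ℕ} (hk : 2 ≤ k) (b : Bool) : xiL k (b, k - 1) = [(!b, 0)] := by
  simp [xiL, show k - 1 ≠ 0 by omega]

theorem xiL_succ {k i : ℕ} (b : Bool) (h0 : i ≠ 0) (h1 : i ≠ k - 1) :
    xiL k (b, i) = [(b, i + 1)] := by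
  simp [xiL, h0, h1]

/-- Each letter `a` is of exactly one of the three kinds distinguished by the morphism. -/
theorem xiL_cases {k : ℕ} (hk : 2 ≤ k) (a : Letter) :
    (a.2 = 0 ∧ xiL k a = [(a.1, 0), (a.1, 1)]) ∨
      (a.2 = k - 1 ∧ xiL k a = [(!a.1, 0)]) ∨
      (a.2 ≠ 0 ∧ a.2 ≠ k - 1 ∧ xiL k a = [(a.1, a.2 + 1)]) := by
  obtain ⟨b, i⟩ := a
  by_cases h0 : i = 0
  · subst h0; exact Or.inl ⟨rfl, rfl⟩
  by_cases h1 : i = k - 1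
  · subst h1; exact Or.inr (Or.inl ⟨rfl, xiL_top hk b⟩)
  · exact Or.inr (Or.inr ⟨h0, h1, xiL_succ b h0 h1⟩)

theorem one_le_length_xiL {k : ℕ} (hk : 2 ≤ k) (a : Letter) : 1 ≤ (xiL k a).length := by
  rcases xiL_cases hk a with ⟨-, h⟩ | ⟨-, h⟩ | ⟨-, -, h⟩ <;> simp [h]

theorem length_le_length_xiW {k : ℕ} (hk : 2 ≤ k) (w : List Letter) :
    w.length ≤ (xiW k w).length := by
  induction w with
  | nil => simp
  | cons a w ih =>
    have := one_le_length_xiL hk a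
    rw [xiW_cons, List.length_append, List.length_cons]
    omega

theorem exists_xiPow_eq_cons {k : ℕ} (hk : 2 ≤ k) (n : ℕ) :
    ∃ w, xiPow k n = (false, 0) :: w ∧ n ≤ w.length := by
  induction n with
  | zero => exact ⟨[], rfl, le_rfl⟩
  | succ n ih =>
    obtain ⟨w, hw, hn⟩ := ih
    refine ⟨(false, 1) :: xiW k w, ?_, ?_⟩
    · rw [xiPow_succ, hw, xiW_cons, xiL_zero]; rfl
    · have := length_le_length_xiW hk w
      rw [List.length_cons]
      omega

theorem getLast?_xiW {k : ℕ} {w : List Letter} {a b : Letter} (hw : w.getLast? = some a)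
    (ha : (xiL k a).getLast? = some b) : (xiW k w).getLast? = some b := by
  obtain ⟨z, rfl⟩ := List.getLast?_eq_some_iff.1 hw
  simp [xiW, List.getLast?_append, ha]

theorem getLast?_xiPow_of_lt {k : ℕ} (hk : 2 ≤ k) {n : ℕ} (hn : n < k) :
    (xiPow k n).getLast? = some (false, n) := by
  induction n with
  | zero => rfl
  | succ n ih =>
    rw [xiPow_succ]
    refine getLast?_xiW (ih (by omega)) ?_
    by_cases h0 : n = 0
    · subst h0; rfl
    · rw [xiL_succ _ h0 (by omega)]; rfl

theorem getLast?_xiPow_add {k : ℕ} (hk : 2 ≤ k) {m : ℕ} (hm : m < k) :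
    (xiPow k (k + m)).getLast? = some (true, m) := by
  induction m with
  | zero =>
    have h : k + 0 = (k - 1) + 1 := by omega
    rw [h, xiPow_succ]
    refine getLast?_xiW (getLast?_xiPow_of_lt hk (by omega)) ?_
    rw [xiL_top hk]; rfl
  | succ m ih =>
    rw [← add_assoc, xiPow_succ]
    refine getLast?_xiW (ih (by omega)) ?_
    by_cases h0 : m = 0
    · subst h0; rfl
    · rw [xiL_succ _ h0 (by omega)]; rfl

/-- The position in `ξ(u)` at which the image of the letter `u n` begins. -/
def cut (k : ℕ) (u : ℕ → Letter) : ℕ → ℕ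
  | 0 => 0
  | n + 1 => cut k u n + (xiL k (u n)).length

theorem occursAt_xiL_of_xiW {k : ℕ} {u : ℕ → Letter} {w : List Letter} {n : ℕ}
    (hw : OccursAt w u n) (hx : OccursAt (xiW k w) u (cut k u n)) {i : ℕ} (hi : i < w.length) :
    OccursAt (xiL k (u (n + i))) u (cut k u (n + i)) := by
  induction w generalizing n i with
  | nil => simp at hi
  | cons a w ih =>
    obtain ⟨rfl, hw'⟩ := occursAt_cons.1 hw
    rw [xiW_cons] at hx
    obtain ⟨h0, hx⟩ := occursAt_append.1 hx
    cases i with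
    | zero => exact h0
    | succ i =>
      have := ih hw' hx (i := i) (by simpa using hi)
      rwa [show n + 1 + i = n + (i + 1) by omega] at this

theorem IsFixedPoint.occursAt_xiL {k : ℕ} (hk : 2 ≤ k) {u : ℕ → Letter} (hu : IsFixedPoint k u)
    (n : ℕ) : OccursAt (xiL k (u n)) u (cut k u n) := by
  obtain ⟨w, hw, hn⟩ := exists_xiPow_eq_cons hk n
  have h1 : OccursAt (xiW k (xiPow k n)) u (cut k u 0) := by
    rw [← xiPow_succ]; exact hu (n + 1)
  have := occursAt_xiL_of_xiW (hu n) h1 (i := n) (by rw [hw, List.length_cons]; omega)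
  rwa [zero_add] at this

section Desubstitution

variable {k : ℕ} {u : ℕ → Letter}

theorem IsFixedPoint.occursAt_xiW (hk : 2 ≤ k) (hu : IsFixedPoint k u) {w : List Letter} {n : ℕ}
    (hw : OccursAt w u n) :
    OccursAt (xiW k w) u (cut k u n) ∧
      cut k u (n + w.length) = cut k u n + (xiW k w).length := by
  induction w generalizing n with
  | nil => exact ⟨occursAt_nil _, rfl⟩
  | cons a w ih =>
    obtain ⟨rfl, hw'⟩ := occursAt_cons.1 hw
    obtain ⟨h1, h2⟩ := ih hw'
    rw [xiW_cons, occursAt_append, List.length_cons, List.length_append,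
      show n + (w.length + 1) = n + 1 + w.length by omega, h2]
    exact ⟨⟨hu.occursAt_xiL hk n, h1⟩, by rw [cut, add_assoc]⟩

/-- The shape of `u` around the image of the letter `u n`. -/
theorem IsFixedPoint.image_cases (hk : 2 ≤ k) (hu : IsFixedPoint k u) (n : ℕ) :
    ((u n).2 = 0 ∧ u (cut k u n) = ((u n).1, 0) ∧ u (cut k u n + 1) = ((u n).1, 1) ∧
        cut k u (n + 1) = cut k u n + 2) ∨
      ((u n).2 = k - 1 ∧ u (cut k u n) = (!(u n).1, 0) ∧ cut k u (n + 1) = cut k u n + 1) ∨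
      ((u n).2 ≠ 0 ∧ (u n).2 ≠ k - 1 ∧ u (cut k u n) = ((u n).1, (u n).2 + 1) ∧
        cut k u (n + 1) = cut k u n + 1) := by
  have h := hu.occursAt_xiL hk n
  rcases xiL_cases hk (u n) with ⟨h0, hx⟩ | ⟨h0, hx⟩ | ⟨h0, h1, hx⟩ <;>
    rw [hx] at h <;> simp only [occursAt_cons] at h <;> simp [h0, h, cut, hx]
  exact h1

theorem IsFixedPoint.snd_cut_ne_one (hk : 2 ≤ k) (hu : IsFixedPoint k u) (n : ℕ) :
    (u (cut k u n)).2 ≠ 1 := by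
  rcases hu.image_cases hk n with ⟨-, h, -⟩ | ⟨-, h, -⟩ | ⟨h0, -, h, -⟩ <;> simp [h]
  exact h0

theorem IsFixedPoint.exists_cut (hk : 2 ≤ k) (hu : IsFixedPoint k u) (j : ℕ) :
    ∃ n, j = cut k u n ∨ (j = cut k u n + 1 ∧ (u n).2 = 0 ∧ u j = ((u n).1, 1)) := by
  induction j with
  | zero => exact ⟨0, Or.inl rfl⟩
  | succ j ih =>
    obtain ⟨n, rfl | ⟨rfl, h0, -⟩⟩ := ih
    · rcases hu.image_cases hk n with ⟨h0, -, h1, -⟩ | ⟨-, -, h⟩ | ⟨-, -, -, h⟩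
      · exact ⟨n, Or.inr ⟨rfl, h0, h1⟩⟩
      · exact ⟨n + 1, Or.inl h.symm⟩
      · exact ⟨n + 1, Or.inl h.symm⟩
    · rcases hu.image_cases hk n with ⟨-, -, -, h⟩ | ⟨h, -⟩ | ⟨h, -⟩
      · exact ⟨n + 1, Or.inl h.symm⟩
      · omega
      · exact absurd h0 h

theorem IsFixedPoint.exists_eq_cut (hk : 2 ≤ k) (hu : IsFixedPoint k u) {j : ℕ}
    (hj : (u j).2 ≠ 1) : ∃ n, j = cut k u n := by
  obtain ⟨n, h | ⟨-, -, h⟩⟩ := hu.exists_cut hk j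
  · exact ⟨n, h⟩
  · simp [h] at hj

/-- A letter `i + 1` satisfies `i + 1 < k` and is always preceded by the letter `i`. -/
theorem IsFixedPoint.pred_eq (hk : 2 ≤ k) (hu : IsFixedPoint k u) {b : Bool} {i j : ℕ}
    (hj : u j = (b, i + 1)) : i + 1 < k ∧ ∃ j', j = j' + 1 ∧ u j' = (b, i) := by
  induction i generalizing j with
  | zero =>
    refine ⟨by omega, ?_⟩
    obtain ⟨n, rfl | ⟨rfl, h0, h1⟩⟩ := hu.exists_cut hk j
    · exact absurd (by rw [hj]) (hu.snd_cut_ne_one hk n)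
    · refine ⟨_, rfl, ?_⟩
      rcases hu.image_cases hk n with ⟨-, h, h', -⟩ | ⟨h, -⟩ | ⟨h, -⟩
      · rw [hj] at h'
        rw [h, ← (Prod.ext_iff.1 h').1]
      · omega
      · exact absurd h0 h
  | succ i ih =>
    obtain ⟨n, rfl⟩ := hu.exists_eq_cut hk (j := j) (by rw [hj]; simp)
    rcases hu.image_cases hk n with ⟨-, h, -⟩ | ⟨-, h, -⟩ | ⟨h0, h1, h, -⟩
    · simp [hj] at h
    · simp [hj] at h
    · rw [hj] at h
      have hn : u n = (b, i + 1) := by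
        obtain ⟨ha, hb⟩ := Prod.ext_iff.1 h
        exact Prod.ext ha.symm (by simpa using hb.symm)
      obtain ⟨hi, n', rfl, hpre⟩ := ih hn
      rw [hn] at h1
      refine ⟨by simp only at h1; omega, ?_⟩
      rcases hu.image_cases hk n' with ⟨h0', -, h', hc⟩ | ⟨h', -⟩ | ⟨-, -, hval, hc⟩
      · refine ⟨_, hc, ?_⟩
        rw [hpre] at h0'
        obtain rfl : i = 0 := h0'
        rw [h', hpre]
      · rw [hpre] at h'
        simp only at h'
        omega
      · exact ⟨_, hc, by rw [hval, hpre]⟩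

/-- A letter `i` is always preceded by the word `0 1 ⋯ (i - 1)`. -/
theorem IsFixedPoint.run_eq (hk : 2 ≤ k) (hu : IsFixedPoint k u) {b : Bool} {i j : ℕ}
    (hj : u j = (b, i)) {d : ℕ} (hd : d ≤ i) : d ≤ j ∧ u (j - d) = (b, i - d) := by
  induction d with
  | zero => exact ⟨Nat.zero_le _, hj⟩
  | succ d ih =>
    obtain ⟨h1, h2⟩ := ih (by omega)
    rw [show i - d = (i - (d + 1)) + 1 by omega] at h2
    obtain ⟨-, j', h3, h4⟩ := hu.pred_eq hk h2
    exact ⟨by omega, by rwa [show j - (d + 1) = j' by omega]⟩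

theorem snd_ne_one_of_occursAt_xiW (hk : 2 ≤ k) {w : List Letter} {c : Bool} {j : ℕ}
    (h : OccursAt (xiW k w ++ [(c, 0)]) u j) : (u j).2 ≠ 1 := by
  cases w with
  | nil =>
    rw [occursAt_singleton.1 h]
    simp
  | cons a w =>
    rw [xiW_cons] at h
    rcases xiL_cases hk a with ⟨-, hx⟩ | ⟨-, hx⟩ | ⟨h0, -, hx⟩ <;>
      rw [hx, List.append_assoc, List.cons_append, occursAt_cons] at h <;> simp [h.1]
    exact h0

theorem IsFixedPoint.desubstitute (hk : 2 ≤ k) (hu : IsFixedPoint k u) {w : List Letter}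
    {c : Bool} {n : ℕ} (h : OccursAt (xiW k w ++ [(c, 0)]) u (cut k u n)) :
    OccursAt w u n ∧ u (cut k u (n + w.length)) = (c, 0) := by
  induction w generalizing n with
  | nil => exact ⟨occursAt_nil _, occursAt_singleton.1 h⟩
  | cons a w ih =>
    rw [xiW_cons, List.append_assoc, occursAt_append] at h
    suffices hs : u n = a ∧ cut k u (n + 1) = cut k u n + (xiL k a).length by
      rw [← hs.2] at h
      obtain ⟨h1, h2⟩ := ih h.2
      rw [occursAt_cons, List.length_cons, show n + (w.length + 1) = n + 1 + w.length by omega]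
      exact ⟨⟨hs.1, h1⟩, h2⟩
    suffices hs : u n = a from ⟨hs, by rw [cut, hs]⟩
    obtain ⟨h1, h2⟩ := h
    have hnext := snd_ne_one_of_occursAt_xiW hk h2
    rcases xiL_cases hk a with ⟨h0, hx⟩ | ⟨h0, hx⟩ | ⟨h0, h0', hx⟩ <;>
      rw [hx] at h1 hnext <;> simp only [occursAt_cons] at h1 <;>
      rcases hu.image_cases hk n with ⟨g0, g1, g2, g3⟩ | ⟨g0, g1, g2⟩ | ⟨g0, g0', g1, g2⟩
    · rw [h1.1] at g1
      exact Prod.ext (Prod.ext_iff.1 g1).1.symm (by omega)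
    · exact absurd (by rw [g2, h1.2.1]) (hu.snd_cut_ne_one hk (n + 1))
    · rw [h1.1] at g1
      simp at g1
    · exact absurd (by simp [g2]) hnext
    · rw [h1.1] at g1
      exact Prod.ext (Bool.not_inj (Prod.ext_iff.1 g1).1).symm (by omega)
    · rw [h1.1] at g1
      simp at g1
    · rw [h1.1] at g1
      simp at g1
    · rw [h1.1] at g1
      simp at g1
    · rw [h1.1] at g1
      obtain ⟨ha, hb⟩ := Prod.ext_iff.1 g1
      exact Prod.ext ha.symm (by simpa using hb.symm)

theorem IsFixedPoint.desubstitute_of_getLast? (hk : 3 ≤ k) (hu : IsFixedPoint k u)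
    {w : List Letter} {c : Bool} {a : Letter} (hw : w.getLast? = some a) (ha : a ≠ (!c, k - 2))
    {j : ℕ} (h : OccursAt (xiW k w ++ [(c, 0)]) u j) :
    ∃ n, j = cut k u n ∧ OccursAt (w ++ [(c, 0)]) u n := by
  have hk' : 2 ≤ k := by omega
  obtain ⟨n, rfl⟩ := hu.exists_eq_cut hk' (snd_ne_one_of_occursAt_xiW hk' h)
  obtain ⟨h1, h2⟩ := hu.desubstitute hk' h
  refine ⟨n, rfl, occursAt_append.2 ⟨h1, occursAt_singleton.2 ?_⟩⟩
  obtain ⟨hpos, hlast⟩ := h1.last hw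
  rcases hu.image_cases hk' (n + w.length) with ⟨g0, g, -⟩ | ⟨g0, g, -⟩ | ⟨-, -, g, -⟩
  · rw [h2] at g
    exact Prod.ext (Prod.ext_iff.1 g).1.symm g0
  · rw [h2] at g
    have hu' : u (n + w.length) = (!c, k - 2 + 1) :=
      Prod.ext (Bool.eq_not.2 fun e => by simp [e] at g) (by simp only; omega)
    obtain ⟨-, j', hj', he⟩ := hu.pred_eq hk' hu'
    rw [show n + w.length - 1 = j' by omega, he] at hlast
    exact absurd hlast.symm ha
  · rw [h2] at g
    simp at g

theorem IsFixedPoint.pred_of_zero_zero (hk : 3 ≤ k) (hu : IsFixedPoint k u) {b c : Bool} {j : ℕ}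
    (h : u j = (b, 0)) (h' : u (j + 1) = (c, 0)) :
    ∃ i, j = i + 1 ∧ u i = (!b, k - 1) := by
  have hk' : 2 ≤ k := by omega
  obtain ⟨n, rfl⟩ := hu.exists_eq_cut hk' (j := j) (by simp [h])
  rcases hu.image_cases hk' n with ⟨-, -, g, -⟩ | ⟨g0, g, -⟩ | ⟨-, -, g, -⟩
  · simp [h'] at g
  · rw [h] at g
    have hn : u n = (!b, k - 2 + 1) :=
      Prod.ext (Bool.eq_not.2 fun e => by simp [e] at g) (by simp only; omega)
    obtain ⟨-, m, rfl, hm⟩ := hu.pred_eq hk' hn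
    rcases hu.image_cases hk' m with ⟨e, -⟩ | ⟨e, -⟩ | ⟨-, -, e, ec⟩
    · rw [hm] at e
      simp only at e
      omega
    · rw [hm] at e
      simp only at e
      omega
    · refine ⟨_, ec, ?_⟩
      rw [e, hm, show k - 2 + 1 = k - 1 by omega]
  · simp [h] at g

/-- Under suitable conditions, an occurrence of `ξ^{L+1}(0)` followed by a letter `0` or `0′`
is preceded by `ξ^L(0)`. -/
theorem IsFixedPoint.exists_occursAt_before (hk : 3 ≤ k) (hu : IsFixedPoint k u) {c : Bool}
    {L : ℕ} (hL : (c = true ∧ L + 1 ≤ k - 2) ∨ (c = false ∧ L + 1 ≤ 2 * k - 2)) {j : ℕ}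
    (h : OccursAt (xiPow k (L + 1) ++ [(c, 0)]) u j) :
    ∃ i, j = i + (xiPow k L).length ∧ OccursAt (xiPow k L) u i := by
  have hk' : 2 ≤ k := by omega
  have hlast : ∃ a, (xiPow k L).getLast? = some a ∧ a ≠ (!c, k - 2) := by
    rcases lt_or_ge L k with hlt | hge
    · refine ⟨_, getLast?_xiPow_of_lt hk' hlt, fun e => ?_⟩
      obtain ⟨e1, e2⟩ := Prod.ext_iff.1 e
      rcases hL with ⟨rfl, hL⟩ | ⟨rfl, hL⟩
      · simp only at e2
        omega
      · simp at e1
    · obtain ⟨m, rfl⟩ := Nat.exists_eq_add_of_le hge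
      refine ⟨_, getLast?_xiPow_add hk' (m := m) (by omega), fun e => ?_⟩
      have e2 := (Prod.ext_iff.1 e).2
      simp only at e2
      omega
  obtain ⟨a, ha, hac⟩ := hlast
  rw [xiPow_succ] at h
  obtain ⟨n, rfl, hn⟩ := hu.desubstitute_of_getLast? hk ha hac h
  cases L with
  | zero =>
    obtain ⟨h1, h2⟩ := occursAt_cons.1 hn
    obtain ⟨i, rfl, hi⟩ := hu.pred_of_zero_zero hk h1 (occursAt_singleton.1 h2)
    rcases hu.image_cases hk' i with ⟨e, -⟩ | ⟨-, e, ec⟩ | ⟨-, e, -⟩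
    · rw [hi] at e
      simp only at e
      omega
    · exact ⟨_, ec, occursAt_singleton.2 (by rw [e, hi]; rfl)⟩
    · rw [hi] at e
      exact absurd rfl e
  | succ L =>
    obtain ⟨i, rfl, hi⟩ := IsFixedPoint.exists_occursAt_before hk hu
      (hL.imp (And.imp_right (by omega)) (And.imp_right (by omega))) hn
    obtain ⟨h1, h2⟩ := hu.occursAt_xiW hk' hi
    rw [xiPow_succ]
    exact ⟨_, h2, h1⟩

/-- A letter following `(b, m)` is `(b, m + 1)` or a letter with index zero. -/
theorem IsFixedPoint.succ_cases (hk : 2 ≤ k) (hu : IsFixedPoint k u) {w : List Letter}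
    {b : Bool} {m : ℕ} (hw : w.getLast? = some (b, m)) {x : Letter} (hx : x ∈ Rext w u) :
    x = (b, m + 1) ∨ x = (x.1, 0) := by
  obtain ⟨j, hj⟩ := hx
  obtain ⟨h1, h2⟩ := occursAt_append.1 hj
  obtain ⟨hpos, hlast⟩ := h1.last hw
  have h2 := occursAt_singleton.1 h2
  obtain ⟨c, i⟩ := x
  cases i with
  | zero => exact Or.inr rfl
  | succ i =>
    obtain ⟨-, j', hj', he⟩ := hu.pred_eq hk h2
    rw [show j + w.length - 1 = j' by omega, he] at hlast
    obtain ⟨rfl, rfl⟩ := Prod.ext_iff.1 hlast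
    exact Or.inl rfl

/-- If `π` is constant on a word `s` preceding an occurrence of `ξ^{L+1}(0)` followed by a letter
`0` or `0′`, and the last letter of `ξ^L(0)` has index `m ≥ 1`, then `|s| ≤ m`. -/
theorem IsFixedPoint.length_le_of_proj_eq (hk : 3 ≤ k) (hu : IsFixedPoint k u) {b c : Bool}
    {L m : ℕ} (hL : (c = true ∧ L + 1 ≤ k - 2) ∨ (c = false ∧ L + 1 ≤ 2 * k - 2))
    (hm : 1 ≤ m) (hlast : (xiPow k L).getLast? = some (b, m)) {s : List Letter}
    (hs : FactorOf (s ++ xiPow k (L + 1) ++ [(c, 0)]) u) {e : Bool}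
    (he : ∀ a ∈ s, proj a = e) : s.length ≤ m := by
  by_contra! hlen
  obtain ⟨j, hj⟩ := hs
  rw [List.append_assoc] at hj
  obtain ⟨h1, h2⟩ := occursAt_append.1 hj
  obtain ⟨i, hi, hw⟩ := hu.exists_occursAt_before hk hL h2
  obtain ⟨hpos, hl⟩ := hw.last hlast
  have key : ∀ p < s.length, proj (u (j + p)) = e := fun p hp =>
    he _ (List.mem_of_getElem? (h1 p hp))
  obtain ⟨h3, h4⟩ := hu.run_eq (by omega) hl (le_refl m)
  have k1 := key (s.length - 1) (by omega)
  have k2 := key (s.length - 1 - m) (by omega)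
  rw [show j + (s.length - 1) = i + (xiPow k L).length - 1 by omega, hl] at k1
  rw [show j + (s.length - 1 - m) = i + (xiPow k L).length - 1 - m by omega, h4] at k2
  simp [proj, show m ≠ 0 by omega] at k1 k2
  rw [← k2] at k1
  simp at k1

/-- Two distinct right extensions with the same projection include a letter `0` or `0′`. -/
theorem IsFixedPoint.eq_zero_of_proj_eq (hk : 2 ≤ k) (hu : IsFixedPoint k u) {w : List Letter}
    {c : Bool} {m : ℕ} (hw : w.getLast? = some (!c, m)) {x y : Letter} (hxy : x ≠ y)
    (hx : x ∈ Rext w u) (hy : y ∈ Rext w u) (hproj : proj x = proj y) :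
    x = (c, 0) ∨ y = (c, 0) := by
  rcases hu.succ_cases hk hw hx with h1 | h1 <;> rcases hu.succ_cases hk hw hy with h2 | h2
  · exact absurd (h1.trans h2.symm) hxy
  · rw [h1, h2] at hproj
    right
    rw [h2]
    simpa [proj] using hproj.symm
  · rw [h1, h2] at hproj
    left
    rw [h1]
    simpa [proj] using hproj
  · rw [h1, h2] at hproj
    exact absurd (by rw [h1, h2]; simpa [proj] using hproj) hxy

end Desubstitution

/-- for `k ≥ 4`, `w = ξ^ℓ(0)` with `2 ≤ ℓ ≤ k−2` or `k+2 ≤ ℓ ≤ 2k−2`,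
if `x ≠ y` are right extensions of `w` with `π(x) = π(y)` and `swx, twy` are factors
of `u_k` with `π(s) = π(t)` a prefix of `1^{k−1}` or of `0^{k−1}`, then
`|s| = |t| ≤ k − 3`. -/
theorem stmt_15 (k : ℕ) (hk : 4 ≤ k) (u : ℕ → Letter) (hu : IsFixedPoint k u)
    (ℓ : ℕ) (hℓ : (2 ≤ ℓ ∧ ℓ ≤ k - 2) ∨ (k + 2 ≤ ℓ ∧ ℓ ≤ 2 * k - 2))
    (x y : Letter) (hxy : x ≠ y)
    (hx : x ∈ Rext (xiPow k ℓ) u) (hy : y ∈ Rext (xiPow k ℓ) u)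
    (hproj : proj x = proj y)
    (s t : List Letter)
    (hs : FactorOf (s ++ xiPow k ℓ ++ [x]) u) (ht : FactorOf (t ++ xiPow k ℓ ++ [y]) u)
    (hmap : s.map proj = t.map proj)
    (hpref : s.map proj <+: List.replicate (k - 1) true ∨
             s.map proj <+: List.replicate (k - 1) false) :
    s.length = t.length ∧ s.length ≤ k - 3 := by
  have hlen : s.length = t.length := by simpa using congrArg List.length hmap
  refine ⟨hlen, ?_⟩
  obtain ⟨e, he⟩ : ∃ e : Bool, ∀ d ∈ s.map proj, d = e := by
    rcases hpref with h | h
    · exact ⟨true, fun d hd => List.eq_of_mem_replicate (h.subset hd)⟩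
    · exact ⟨false, fun d hd => List.eq_of_mem_replicate (h.subset hd)⟩
  have hse : ∀ a ∈ s, proj a = e := fun a ha => he _ (List.mem_map_of_mem ha)
  have hte : ∀ a ∈ t, proj a = e := fun a ha => he _ (hmap ▸ List.mem_map_of_mem ha)
  obtain ⟨c, L, m, rfl, hL, hm, hmk, hlast, hlast'⟩ : ∃ (c : Bool) (L m : ℕ), ℓ = L + 1 ∧
      ((c = true ∧ L + 1 ≤ k - 2) ∨ (c = false ∧ L + 1 ≤ 2 * k - 2)) ∧ 1 ≤ m ∧ m ≤ k - 3 ∧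
      (xiPow k L).getLast? = some (!c, m) ∧ (xiPow k (L + 1)).getLast? = some (!c, m + 1) := by
    rcases hℓ with ⟨h1, h2⟩ | ⟨h1, h2⟩
    · obtain ⟨L, rfl⟩ := Nat.exists_eq_add_of_le' (show 1 ≤ ℓ by omega)
      exact ⟨true, L, L, rfl, Or.inl ⟨rfl, h2⟩, by omega, by omega,
        getLast?_xiPow_of_lt (by omega) (by omega), getLast?_xiPow_of_lt (by omega) (by omega)⟩
    · obtain ⟨m, rfl⟩ := Nat.exists_eq_add_of_le (show k + 1 ≤ ℓ by omega)
      rw [show k + 1 + m = k + m + 1 by omega] at *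
      exact ⟨false, k + m, m, rfl, Or.inr ⟨rfl, h2⟩, by omega, by omega,
        getLast?_xiPow_add (by omega) (by omega),
        getLast?_xiPow_add (m := m + 1) (by omega) (by omega)⟩
  rcases hu.eq_zero_of_proj_eq (by omega) hlast' hxy hx hy hproj with rfl | rfl
  · exact (hu.length_le_of_proj_eq (by omega) hL hm hlast hs hse).trans hmk
  · rw [hlen]
    exact (hu.length_le_of_proj_eq (by omega) hL hm hlast ht hte).trans hmk
end

section
/- Let k ≥ 4 and let x_k = π(u_k). Let w be a left special factor of x_k with |w| ≥ |ξ^{2k−2}(0)| + k + 2. Then there exist i ∈ {1,…,k} and a left special factor f of u_k such that w or its twin equals 0^{i−1}π(f). -/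
open List Filter Topology

/-- `P m` is the position in `u` at which the image under ξ of the letter at position `m`
begins. -/
structure Desubstitutes (k : ℕ) (u : ℕ → Letter) (P : ℕ → ℕ) : Prop where
  zero : P 0 = 0
  succ : ∀ m, P (m + 1) = P m + (xiL k (u m)).length
  occ : ∀ m, OccursAt (xiL k (u m)) u (P m)
  head : u 0 = (false, 0)

/-- The factor of `v` of length `L` at position `p`. -/
def seg {α : Type*} (v : ℕ → α) (p L : ℕ) : List α := (List.range L).map fun i => v (p + i)

theorem seg_length {α : Type*} (v : ℕ → α) (p L : ℕ) : (seg v p L).length = L := by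
  simp [seg]

theorem seg_add {α : Type*} (v : ℕ → α) (p a b : ℕ) :
    seg v p (a + b) = seg v p a ++ seg v (p + a) b := by
  simp [seg, List.range_add, Function.comp_def, add_assoc]

theorem occursAt_iff_seg {α : Type*} (w : List α) (v : ℕ → α) (p : ℕ) :
    OccursAt w v p ↔ w = seg v p w.length := by
  constructor
  · intro h
    apply List.ext_getElem?
    intro i
    by_cases hi : i < w.length
    · rw [h i hi]; simp [seg, hi]
    · simp [seg, hi]
  · intro h i hi
    rw [h]
    simp [seg, hi]

theorem occursAt_seg {α : Type*} (v : ℕ → α) (p L : ℕ) : OccursAt (seg v p L) v p := by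
  rw [occursAt_iff_seg, seg_length]

theorem xiW_append (k : ℕ) (a b : List Letter) : xiW k (a ++ b) = xiW k a ++ xiW k b := by
  simp [xiW]

theorem xiW_iterate_append (k n : ℕ) (a b : List Letter) :
    (xiW k)^[n] (a ++ b) = (xiW k)^[n] a ++ (xiW k)^[n] b := by
  induction n generalizing a b with
  | zero => rfl
  | succ n ih => simp only [Function.iterate_succ_apply, xiW_append, ih]

theorem xiL_length_pos (k : ℕ) (a : Letter) : 1 ≤ (xiL k a).length := by
  unfold xiL; split_ifs <;> simp

theorem length_le_xiW (k : ℕ) (w : List Letter) : w.length ≤ (xiW k w).length := by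
  induction w with
  | nil => simp
  | cons a t ih =>
    have := xiL_length_pos k a
    simp only [xiW, List.flatMap_cons, List.length_append, List.length_cons] at *
    omega

theorem xiPow_eq_cons (k n : ℕ) : ∃ t, xiPow k n = (false, 0) :: t ∧ n ≤ t.length := by
  induction n with
  | zero => exact ⟨[], rfl, le_rfl⟩
  | succ n ih =>
    obtain ⟨t, ht, hl⟩ := ih
    refine ⟨(false, 1) :: xiW k t, ?_, ?_⟩
    · rw [xiPow_succ, ht]; simp [xiW, xiL]
    · have := length_le_xiW k t
      simp only [List.length_cons]; omega

theorem xiPow_length_mono (k : ℕ) : Monotone fun n => (xiPow k n).length :=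
  monotone_nat_of_le_succ fun n => by rw [xiPow_succ]; exact length_le_xiW _ _

theorem xiW_map_twin (k : ℕ) (w : List Letter) : xiW k (w.map twin) = (xiW k w).map twin := by
  induction w with
  | nil => rfl
  | cons a t ih =>
    have h : xiL k (twin a) = (xiL k a).map twin := by
      unfold xiL twin; split_ifs <;> simp_all
    simp only [xiW, List.map_cons, List.flatMap_cons, List.map_append] at *
    rw [h, ih]

theorem xiW_iterate_map_twin (k n : ℕ) (w : List Letter) :
    (xiW k)^[n] (w.map twin) = ((xiW k)^[n] w).map twin := by
  induction n generalizing w with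
  | zero => rfl
  | succ n ih => simp only [Function.iterate_succ_apply, xiW_map_twin, ih]

theorem length_xiW_iterate_zero (k n : ℕ) (b : Bool) :
    ((xiW k)^[n] [(b, 0)]).length = (xiPow k n).length := by
  cases b with
  | false => rfl
  | true =>
    have := xiW_iterate_map_twin k n [(false, 0)]
    simp only [List.map_cons, List.map_nil, twin, Bool.not_false] at this
    rw [this, List.length_map, xiPow]

theorem xiW_iterate_one {k : ℕ} (hk : 4 ≤ k) (b : Bool) :
    (xiW k)^[k - 1] [(b, 1)] = [(!b, 0)] := by
  have h : ∀ j, j + 1 < k → (xiW k)^[j] [(b, 1)] = [(b, j + 1)] := by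
    intro j
    induction j with
    | zero => intro _; rfl
    | succ j ih =>
      intro hj
      rw [Function.iterate_succ_apply', ih (by omega)]
      have : j + 1 ≠ k - 1 := by omega
      simp [xiW, xiL, this]
  obtain ⟨m, rfl⟩ : ∃ m, k = m + 2 := ⟨k - 2, by omega⟩
  rw [show m + 2 - 1 = m + 1 from rfl, Function.iterate_succ_apply', h m (by omega)]
  simp [xiW, xiL]

theorem xiW_iterate_zero_append {k : ℕ} (hk : 4 ≤ k) (b : Bool) :
    (xiW k)^[k - 1] [(b, 0)] ++ [(!b, 0)] = (xiW k)^[k] [(b, 0)] := by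
  rw [← xiW_iterate_one hk b, ← xiW_iterate_append]
  obtain ⟨m, rfl⟩ : ∃ m, k = m + 1 := ⟨k - 1, by omega⟩
  rw [Function.iterate_succ_apply (xiW (m + 1)) m]
  simp [xiW, xiL]

theorem occursAt_of_prefix {α : Type*} {a b : List α} {v : ℕ → α} {p : ℕ} (h : a <+: b)
    (hb : OccursAt b v p) : OccursAt a v p := by
  obtain ⟨t, rfl⟩ := h
  intro i hi
  rw [← hb i (by simp; omega), List.getElem?_append_left hi]

theorem IsFixedPoint.desubstitutes {k : ℕ} {u : ℕ → Letter} (hu : IsFixedPoint k u) :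
    ∃ P, Desubstitutes k u P := by
  have hpre : ∀ m, OccursAt (xiW k (seg u 0 m)) u 0 := by
    intro m
    have h1 := (occursAt_iff_seg _ _ _).mp (hu m)
    obtain ⟨t, ht, hl⟩ := xiPow_eq_cons k m
    have hlen : m ≤ (xiPow k m).length := by rw [ht]; simp; omega
    refine occursAt_of_prefix ?_ (hu (m + 1))
    obtain ⟨d, hd⟩ := Nat.exists_eq_add_of_le hlen
    rw [xiPow_succ, h1, hd, seg_add, xiW_append]
    exact List.prefix_append _ _
  have hs : ∀ m, xiW k (seg u 0 (m + 1)) = xiW k (seg u 0 m) ++ xiL k (u m) := by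
    intro m
    rw [seg_add, xiW_append]; simp [seg, xiW]
  refine ⟨fun m => (xiW k (seg u 0 m)).length, ⟨rfl, fun m => ?_, fun m i hi => ?_, ?_⟩⟩
  · simp only [hs, List.length_append]
  · have := hpre (m + 1)
    rw [hs] at this
    have h2 := this ((xiW k (seg u 0 m)).length + i) (by simp [hi])
    rw [zero_add, List.getElem?_append_right (by omega)] at h2
    simpa using h2
  · have := hu 0 0 (by simp [xiPow])
    simpa [xiPow] using this.symm


theorem occursAt_append_right {α : Type*} {a b : List α} {v : ℕ → α} {p : ℕ}
    (h : OccursAt (a ++ b) v p) : OccursAt b v (p + a.length) := by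
  intro i hi
  have := h (a.length + i) (by simp [hi])
  rw [List.getElem?_append_right (by omega)] at this
  simpa [add_assoc] using this

theorem IsFixedPoint.factorOf_map_twin {k : ℕ} (hk : 4 ≤ k) {u : ℕ → Letter}
    (hu : IsFixedPoint k u) {f : List Letter} (hf : FactorOf f u) :
    FactorOf (f.map twin) u := by
  obtain ⟨p, hp⟩ := hf
  have hpre : xiPow k (p + f.length) = seg u 0 (xiPow k (p + f.length)).length :=
    (occursAt_iff_seg _ _ _).mp (hu _)
  obtain ⟨t, ht, hl⟩ := xiPow_eq_cons k (p + f.length)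
  obtain ⟨d, hd⟩ : ∃ d, (xiPow k (p + f.length)).length = p + (f.length + d) := by
    have : p + f.length ≤ (xiPow k (p + f.length)).length := by rw [ht]; simp; omega
    exact ⟨(xiPow k (p + f.length)).length - (p + f.length), by omega⟩
  rw [hd, seg_add, seg_add, zero_add, ← (occursAt_iff_seg _ _ _).mp hp] at hpre
  have h1 : xiPow k (p + f.length + k) = (xiW k)^[p + f.length] ((xiW k)^[k - 1] [(false, 0)])
      ++ (xiPow k (p + f.length)).map twin := by
    rw [xiPow, Function.iterate_add_apply, ← xiW_iterate_zero_append hk, xiW_iterate_append]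
    congr 1
    rw [xiPow, ← xiW_iterate_map_twin]; rfl
  have h2 := hu (p + f.length + k)
  rw [h1, hpre] at h2
  simp only [List.map_append] at h2
  exact ⟨_, occursAt_of_prefix (List.prefix_append _ _)
    (occursAt_append_right (occursAt_append_right h2))⟩

theorem IsFixedPoint.leftSpecial_map_twin {k : ℕ} (hk : 4 ≤ k) {u : ℕ → Letter}
    (hu : IsFixedPoint k u) {f : List Letter} (hf : LeftSpecial f u) :
    LeftSpecial (f.map twin) u := by
  obtain ⟨a, b, hab, ha, hb⟩ := hf
  refine ⟨twin a, twin b, ?_, hu.factorOf_map_twin hk ha, hu.factorOf_map_twin hk hb⟩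
  rintro h
  simp only [twin, Prod.mk.injEq, Bool.not_inj_iff] at h
  exact hab (Prod.ext h.1 h.2)

namespace Desubstitutes

variable {k : ℕ} {u : ℕ → Letter} {P : ℕ → ℕ}

theorem image_zero (hd : Desubstitutes k u P) {m : ℕ} {b : Bool} (h : u m = (b, 0)) :
    u (P m) = (b, 0) ∧ u (P m + 1) = (b, 1) ∧ P (m + 1) = P m + 2 := by
  have h0 := hd.occ m
  have h1 := hd.succ m
  rw [h] at h0 h1
  have a0 := h0 0 (by simp [xiL])
  have a1 := h0 1 (by simp [xiL])
  simp [xiL] at a0 a1 h1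
  exact ⟨a0.symm, a1.symm, h1⟩

theorem image_last (hd : Desubstitutes k u P) (hk : 4 ≤ k) {m : ℕ} {b : Bool}
    (h : u m = (b, k - 1)) : u (P m) = (!b, 0) ∧ P (m + 1) = P m + 1 := by
  have h0 := hd.occ m
  have h1 := hd.succ m
  rw [h] at h0 h1
  have hk' : k - 1 ≠ 0 := by omega
  have a0 := h0 0 (by simp [xiL, hk'])
  simp [xiL, hk'] at a0 h1
  exact ⟨a0.symm, h1⟩

theorem image_of_ne (hd : Desubstitutes k u P) {m : ℕ} {b : Bool} {j : ℕ}
    (h : u m = (b, j + 1)) (hj : j + 1 ≠ k - 1) :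
    u (P m) = (b, j + 2) ∧ P (m + 1) = P m + 1 := by
  have h0 := hd.occ m
  have h1 := hd.succ m
  rw [h] at h0 h1
  have a0 := h0 0 (by simp [xiL, hj])
  simp [xiL, hj] at a0 h1
  exact ⟨a0.symm, h1⟩

theorem strictMono (hd : Desubstitutes k u P) : StrictMono P :=
  strictMono_nat_of_lt_succ fun m => by
    rw [hd.succ]; have := xiL_length_pos k (u m); omega

theorem lt_image (hd : Desubstitutes k u P) {m : ℕ} (hm : 1 ≤ m) : m < P m := by
  induction m, hm using Nat.le_induction with
  | base => rw [hd.succ, hd.zero, hd.head]; simp [xiL]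
  | succ m _ ih => exact lt_of_le_of_lt ih (hd.strictMono (Nat.lt_succ_self m))

/-- Every position of `u` lies in the image of a letter. -/
theorem exists_image (hd : Desubstitutes k u P) (hk : 4 ≤ k) (n : ℕ) :
    ∃ m, n = P m ∨ n = P m + 1 ∧ (u m).2 = 0 := by
  induction n with
  | zero => exact ⟨0, Or.inl hd.zero.symm⟩
  | succ n ih =>
    obtain ⟨m, rfl | ⟨rfl, h0⟩⟩ := ih
    · rcases hm : u m with ⟨b, j⟩
      rcases j with _ | j
      · exact ⟨m, Or.inr ⟨rfl, by simp [hm]⟩⟩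
      · refine ⟨m + 1, Or.inl ?_⟩
        by_cases hj : j + 1 = k - 1
        · rw [hj] at hm; exact (hd.image_last hk hm).2.symm
        · exact (hd.image_of_ne hm hj).2.symm
    · refine ⟨m + 1, Or.inl ?_⟩
      exact (hd.image_zero (b := (u m).1) (Prod.ext rfl h0)).2.2.symm

theorem exists_preimage_zero (hd : Desubstitutes k u P) (hk : 4 ≤ k) {n : ℕ} {b : Bool}
    (h : u n = (b, 0)) : ∃ m, P m = n ∧
      (u m = (b, 0) ∧ u (n + 1) = (b, 1) ∧ P (m + 1) = n + 2 ∨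
        u m = (!b, k - 1) ∧ P (m + 1) = n + 1) := by
  obtain ⟨m, rfl | ⟨rfl, h0⟩⟩ := hd.exists_image hk n
  · refine ⟨m, rfl, ?_⟩
    rcases hm : u m with ⟨c, j⟩
    rcases j with _ | j
    · obtain ⟨h1, h2, h3⟩ := hd.image_zero hm
      rw [h] at h1
      simp only [Prod.mk.injEq, and_true] at h1
      subst h1
      exact Or.inl ⟨rfl, h2, h3⟩
    · by_cases hj : j + 1 = k - 1
      · rw [hj] at hm
        obtain ⟨h1, h2⟩ := hd.image_last hk hm
        rw [h] at h1
        simp only [Prod.mk.injEq, and_true] at h1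
        subst h1
        exact Or.inr ⟨by simp [hj], h2⟩
      · have := (hd.image_of_ne hm hj).1
        rw [h] at this
        simp at this
  · have := (hd.image_zero (b := (u m).1) (Prod.ext rfl h0)).2.1
    rw [h] at this
    simp at this

theorem exists_preimage_one (hd : Desubstitutes k u P) (hk : 4 ≤ k) {n : ℕ} {b : Bool}
    (h : u n = (b, 1)) : ∃ m, n = P m + 1 ∧ u m = (b, 0) ∧ P (m + 1) = n + 1 := by
  obtain ⟨m, rfl | ⟨rfl, h0⟩⟩ := hd.exists_image hk n
  · exfalso
    rcases hm : u m with ⟨c, j⟩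
    rcases j with _ | j
    · have := (hd.image_zero hm).1
      rw [h] at this; simp at this
    · by_cases hj : j + 1 = k - 1
      · rw [hj] at hm
        have := (hd.image_last hk hm).1
        rw [h] at this; simp at this
      · have := (hd.image_of_ne hm hj).1
        rw [h] at this; simp at this
  · have hm : u m = ((u m).1, 0) := Prod.ext rfl h0
    obtain ⟨-, h2, h3⟩ := hd.image_zero hm
    rw [h] at h2
    simp only [Prod.mk.injEq, and_true] at h2
    rw [← h2] at hm
    exact ⟨m, rfl, hm, h3⟩

theorem exists_preimage_add_two (hd : Desubstitutes k u P) (hk : 4 ≤ k) {n : ℕ} {b : Bool}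
    {j : ℕ} (h : u n = (b, j + 2)) :
    ∃ m, P m = n ∧ u m = (b, j + 1) ∧ j + 1 ≠ k - 1 ∧ P (m + 1) = n + 1 := by
  obtain ⟨m, rfl | ⟨rfl, h0⟩⟩ := hd.exists_image hk n
  · rcases hm : u m with ⟨c, i⟩
    rcases i with _ | i
    · have := (hd.image_zero hm).1
      rw [h] at this; simp at this
    · by_cases hj : i + 1 = k - 1
      · rw [hj] at hm
        have := (hd.image_last hk hm).1
        rw [h] at this; simp at this
      · obtain ⟨h1, h2⟩ := hd.image_of_ne hm hj
        rw [h] at h1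
        simp only [Prod.mk.injEq, Nat.add_right_cancel_iff] at h1
        obtain ⟨rfl, rfl⟩ := h1
        exact ⟨m, rfl, hm, hj, h2⟩
  · have := (hd.image_zero (b := (u m).1) (Prod.ext rfl h0)).2.1
    rw [h] at this; simp at this

theorem snd_lt (hd : Desubstitutes k u P) (hk : 4 ≤ k) (n : ℕ) : (u n).2 < k := by
  induction n using Nat.strong_induction_on with
  | _ n ih =>
    rcases hn : u n with ⟨b, _ | _ | j⟩
    · simp; omega
    · simp; omega
    · obtain ⟨m, rfl, hm, hj, -⟩ := hd.exists_preimage_add_two hk hn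
      have hm0 : 1 ≤ m := by
        by_contra hc
        obtain rfl : m = 0 := by omega
        rw [hd.head] at hm; simp at hm
      have := ih m (hd.lt_image hm0)
      rw [hm] at this
      simp at this ⊢; omega

/-- A nonzero letter is preceded by its predecessor. -/
theorem pred_letter (hd : Desubstitutes k u P) (hk : 4 ≤ k) {n : ℕ} {b : Bool} {j : ℕ}
    (h : u (n + 1) = (b, j + 1)) : u n = (b, j) := by
  induction n using Nat.strong_induction_on generalizing j with
  | _ n ih =>
    rcases j with _ | j
    · obtain ⟨m, hm, hb, -⟩ := hd.exists_preimage_one hk h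
      obtain rfl : n = P m := by omega
      exact (hd.image_zero hb).1
    · obtain ⟨m, hm, hb, hj, -⟩ := hd.exists_preimage_add_two hk h
      rcases m with _ | m
      · rw [hd.zero] at hm; omega
      · have hmn : m < n := by
          have := hd.lt_image (m := m + 1) (by omega)
          omega
        have h1 := ih m hmn hb
        rcases j with _ | j
        · obtain ⟨-, h2, h3⟩ := hd.image_zero h1
          obtain rfl : n = P m + 1 := by omega
          exact h2
        · obtain ⟨h2, h3⟩ := hd.image_of_ne h1 (by
            have := hd.snd_lt hk (m + 1); rw [hb] at this; simp at this; omega)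
          obtain rfl : n = P m := by omega
          exact h2

theorem next_letter (hd : Desubstitutes k u P) (hk : 4 ≤ k) {n : ℕ} {b : Bool} {j : ℕ}
    (h : u n = (b, j)) :
    u (n + 1) = (b, j + 1) ∧ j + 1 < k ∨ ∃ c, u (n + 1) = (c, 0) := by
  rcases h1 : u (n + 1) with ⟨c, _ | i⟩
  · exact Or.inr ⟨c, rfl⟩
  · have := hd.pred_letter hk h1
    rw [h] at this
    simp only [Prod.mk.injEq] at this
    obtain ⟨rfl, rfl⟩ := this
    have := hd.snd_lt hk (n + 1)
    rw [h1] at this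
    exact Or.inl ⟨rfl, this⟩

theorem next_last (hd : Desubstitutes k u P) (hk : 4 ≤ k) {n : ℕ} {b : Bool}
    (h : u n = (b, k - 1)) : ∃ c, u (n + 1) = (c, 0) := by
  rcases hd.next_letter hk h with h1 | h1
  · omega
  · exact h1

/-- A zero letter followed by a zero letter ends the image of a last letter. -/
theorem of_zero_zero (hd : Desubstitutes k u P) (hk : 4 ≤ k) {n : ℕ} {b c : Bool}
    (h : u n = (b, 0)) (h1 : u (n + 1) = (c, 0)) :
    ∃ m, P m = n ∧ u m = (!b, k - 1) ∧ P (m + 1) = n + 1 ∧ u (m + 1) = (c, 0) ∧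
      u (n + 2) = (c, 1) := by
  obtain ⟨m, rfl, ⟨-, h2, -⟩ | ⟨h2, h3⟩⟩ := hd.exists_preimage_zero hk h
  · rw [h1] at h2; simp at h2
  · refine ⟨m, rfl, h2, h3, ?_⟩
    obtain ⟨d, hd'⟩ := hd.next_last hk h2
    obtain ⟨h4, h5, -⟩ := hd.image_zero hd'
    rw [h3] at h4 h5
    rw [h1] at h4
    simp only [Prod.mk.injEq, and_true] at h4
    subst h4
    exact ⟨hd', h5⟩

/-- Among two consecutive zero letters, the first is preceded by the last letter of the opposite
sign. -/
theorem pred_of_zero_zero (hd : Desubstitutes k u P) (hk : 4 ≤ k) {n : ℕ} {b c : Bool}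
    (h : u (n + 1) = (b, 0)) (h1 : u (n + 2) = (c, 0)) : u n = (!b, k - 1) := by
  obtain ⟨m, hm, hb, -, -, -⟩ := hd.of_zero_zero hk h h1
  rcases m with _ | m
  · rw [hd.zero] at hm; omega
  · obtain ⟨i, hi⟩ : ∃ i, k = i + 3 := ⟨k - 3, by omega⟩
    have hb' : u (m + 1) = (!b, i + 1 + 1) := by rw [hb]; simp [hi]
    obtain ⟨h2, h3⟩ := hd.image_of_ne (hd.pred_letter hk hb') (by omega)
    obtain rfl : n = P m := by omega
    rw [h2]; simp [hi]

theorem after_nonzero_zero (hd : Desubstitutes k u P) (hk : 4 ≤ k) {n : ℕ} {b c : Bool} {j : ℕ}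
    (h : u n = (b, j + 1)) (h1 : u (n + 1) = (c, 0)) :
    (u (n + 2) = (c, 1) ∧ u (n + 3) = (c, 2)) ∨
      (∃ d, u (n + 2) = (d, 0)) ∧ j + 1 = k - 1 ∧ c = !b := by
  induction n using Nat.strong_induction_on generalizing b c j with
  | _ n ih =>
    rcases hd.next_letter hk h1 with ⟨h2, -⟩ | ⟨d, h2⟩
    · refine Or.inl ⟨h2, ?_⟩
      obtain ⟨m', hm', hc', hs⟩ := hd.exists_preimage_one hk h2
      obtain rfl : n = P m' - 1 := by omega
      rcases m' with _ | m
      · rw [hd.zero] at hm'; omega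
      have key : u (m + 2) = (c, 1) := by
        rcases j with _ | j
        · obtain ⟨l, hl, hb, hl'⟩ := hd.exists_preimage_one hk h
          obtain rfl : l = m := by
            have : P (l + 1) = P (m + 1) := by omega
            have := hd.strictMono.injective this
            omega
          exact (hd.of_zero_zero hk hb hc').choose_spec.2.2.2.2
        · obtain ⟨l, hl, hb, hj, hl'⟩ := hd.exists_preimage_add_two hk h
          obtain rfl : l = m := by
            have : P (l + 1) = P (m + 1) := by omega
            have := hd.strictMono.injective this
            omega
          have hl0 : 1 ≤ l := by
            rcases l with _ | l
            · rw [hd.head] at hb; simp at hb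
            · omega
          have := hd.lt_image hl0
          rcases ih l (by omega) hb hc' with h5 | h5
          · exact h5.1
          · exact absurd h5.2.1 hj
      have := hd.image_of_ne key (by omega)
      rw [show P (m + 2) = P (m + 1) - 1 + 3 by omega] at this
      exact this.1
    · have := hd.pred_of_zero_zero hk h1 h2
      rw [h] at this
      simp only [Prod.mk.injEq] at this
      exact Or.inr ⟨⟨d, h2⟩, this.2, by simp [this.1]⟩

theorem after_zero_zero (hd : Desubstitutes k u P) (hk : 4 ≤ k) {n : ℕ} {b c : Bool}
    (h : u n = (b, 0)) (h1 : u (n + 1) = (c, 0)) :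
    u (n + 2) = (c, 1) ∧ (c = b ∨ u (n + 3) = (c, 2)) := by
  obtain ⟨m, rfl, h2, h3, h4, h5⟩ := hd.of_zero_zero hk h h1
  refine ⟨h5, ?_⟩
  obtain ⟨i, hi⟩ : ∃ i, k = i + 2 := ⟨k - 2, by omega⟩
  have h2' : u m = (!b, i + 1) := by rw [h2]; simp [hi]
  rcases hd.after_nonzero_zero hk h2' h4 with h6 | h6
  · right
    have := hd.image_of_ne h6.1 (by omega)
    rw [(hd.image_zero h4).2.2, h3] at this
    exact this.1
  · left; simp [h6.2.2]

theorem image_end_cases (hd : Desubstitutes k u P) (hk : 4 ≤ k) {m n : ℕ}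
    (h : P (m + 1) = n + 1) :
    (∃ b, u m = (b, 0) ∧ u n = (b, 1)) ∨ (∃ b, u m = (b, k - 1) ∧ u n = (!b, 0)) ∨
      ∃ b j, u m = (b, j + 1) ∧ j + 1 ≠ k - 1 ∧ u n = (b, j + 2) := by
  rcases hm : u m with ⟨b, _ | j⟩
  · obtain ⟨-, h2, h3⟩ := hd.image_zero hm
    obtain rfl : n = P m + 1 := by omega
    exact Or.inl ⟨b, rfl, h2⟩
  · by_cases hj : j + 1 = k - 1
    · rw [hj] at hm
      obtain ⟨h2, h3⟩ := hd.image_last hk hm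
      obtain rfl : n = P m := by omega
      exact Or.inr (Or.inl ⟨b, by rw [hj], h2⟩)
    · obtain ⟨h2, h3⟩ := hd.image_of_ne hm hj
      obtain rfl : n = P m := by omega
      exact Or.inr (Or.inr ⟨b, j, rfl, hj, h2⟩)

/-- Images of letters under ξ are determined by their last letters. -/
theorem image_end_eq_iff (hd : Desubstitutes k u P) (hk : 4 ≤ k) {m n m' n' : ℕ}
    (h : P (m + 1) = n + 1) (h' : P (m' + 1) = n' + 1) : u n = u n' ↔ u m = u m' := by
  rcases hd.image_end_cases hk h with ⟨b, h1, h2⟩ | ⟨b, h1, h2⟩ | ⟨b, j, h1, hj, h2⟩ <;>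
  rcases hd.image_end_cases hk h' with ⟨c, h3, h4⟩ | ⟨c, h3, h4⟩ | ⟨c, i, h3, hi, h4⟩ <;>
  rw [h1, h2, h3, h4] <;> simp <;> omega

theorem exists_preimage_zero_one (hd : Desubstitutes k u P) (hk : 4 ≤ k) {n : ℕ} {b c : Bool}
    (h : u n = (b, 0)) (h1 : u (n + 1) = (c, 1)) : ∃ m, P m = n ∧ u m = (b, 0) := by
  obtain ⟨m, hm, hc, -⟩ := hd.exists_preimage_one hk h1
  obtain rfl : n = P m := by omega
  have := (hd.image_zero hc).1
  rw [h] at this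
  exact ⟨m, rfl, by rw [hc, this]⟩

theorem exists_preimage_of_left_ne (hd : Desubstitutes k u P) (hk : 4 ≤ k) {p q : ℕ}
    (h0 : u p ≠ u q) (h1 : u (p + 1) = u (q + 1)) (h2 : u (p + 2) = u (q + 2)) :
    ∃ p' q', P (p' + 1) = p + 1 ∧ P (q' + 1) = q + 1 ∧ u p' ≠ u q' := by
  rcases hp : u (p + 1) with ⟨b, _ | j⟩
  · have hq := hp
    rw [h1] at hq
    rcases hp2 : u (p + 2) with ⟨c, _ | i⟩
    · have hq2 := hp2
      rw [h2] at hq2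
      exact absurd ((hd.pred_of_zero_zero hk hp hp2).trans
        (hd.pred_of_zero_zero hk hq hq2).symm) h0
    · have hpi := hd.pred_letter hk hp2
      rw [hp] at hpi
      simp only [Prod.mk.injEq] at hpi
      rw [← hpi.2, zero_add] at hp2
      have hq2 := hp2
      rw [h2] at hq2
      obtain ⟨m, hm, -⟩ := hd.exists_preimage_zero_one hk hp hp2
      obtain ⟨l, hl, -⟩ := hd.exists_preimage_zero_one hk hq hq2
      rcases m with _ | m
      · rw [hd.zero] at hm; omega
      rcases l with _ | l
      · rw [hd.zero] at hl; omega
      exact ⟨m, l, hm, hl, fun h => h0 ((hd.image_end_eq_iff hk hm hl).mpr h)⟩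
  · have hq := hp
    rw [h1] at hq
    exact absurd ((hd.pred_letter hk hp).trans (hd.pred_letter hk hq).symm) h0

/-- Equal factors that start and end at boundaries of images have equal preimages. -/
theorem exists_preimage_common (hd : Desubstitutes k u P) (hk : 4 ≤ k) {p q : ℕ} (L : ℕ)
    (hc : ∀ i < L, u (P p + i) = u (P q + i)) {m l : ℕ} (hm : P m = P p + L)
    (hl : P l = P q + L) :
    ∃ L', m = p + L' ∧ l = q + L' ∧ ∀ i < L', u (p + i) = u (q + i) := by
  induction L using Nat.strong_induction_on generalizing m l with
  | _ L ih =>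
    rcases L with _ | L
    · exact ⟨0, hd.strictMono.injective hm, hd.strictMono.injective hl, by simp⟩
    · have hpm : p < m := hd.strictMono.lt_iff_lt.mp (by omega)
      have hql : q < l := hd.strictMono.lt_iff_lt.mp (by omega)
      obtain ⟨m, rfl⟩ : ∃ m', m = m' + 1 := ⟨m - 1, by omega⟩
      obtain ⟨l, rfl⟩ : ∃ l', l = l' + 1 := ⟨l - 1, by omega⟩
      have heq := (hd.image_end_eq_iff hk (n := P p + L) (n' := P q + L) hm hl).mp
        (hc L (by omega))
      have hm' := hd.succ m
      have hl' := hd.succ l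
      rw [← heq] at hl'
      have h1 := xiL_length_pos k (u m)
      have h2 : P p ≤ P m := hd.strictMono.monotone (by omega)
      obtain ⟨L', rfl, rfl, hL⟩ := ih (L + 1 - (xiL k (u m)).length) (by omega)
        (fun i hi => hc i (by omega))
        (show P m = P p + (L + 1 - (xiL k (u m)).length) by omega)
        (show P l = P q + (L + 1 - (xiL k (u m)).length) by omega)
      refine ⟨L' + 1, rfl, rfl, fun i hi => ?_⟩
      rcases Nat.lt_succ_iff_lt_or_eq.mp hi with h | rfl
      · exact hL i h
      · exact heq

theorem seg_image (hd : Desubstitutes k u P) (p : ℕ) {L L' : ℕ} (h : P (p + L') = P p + L) :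
    seg u (P p) L = xiW k (seg u p L') := by
  induction L' generalizing L with
  | zero =>
    obtain rfl : L = 0 := by simpa using h
    rfl
  | succ n ih =>
    have h1 := hd.succ (p + n)
    have h2 : P p ≤ P (p + n) := hd.strictMono.monotone (by omega)
    obtain ⟨d, hd'⟩ := Nat.exists_eq_add_of_le h2
    obtain rfl : L = d + (xiL k (u (p + n))).length := by rw [← add_assoc] at h; omega
    rw [seg_add, seg_add, xiW_append, ih hd', ← hd',
      ← (occursAt_iff_seg _ _ _).mp (hd.occ (p + n))]
    simp [seg, xiW]

end Desubstitutes

/-- The factor of length `L` that follows the positions `p` and `q` extends to the left by the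
distinct letters at these positions, and to the right by `(b, ℓ + 1)` and by the zero letter of the
opposite sign. -/
structure Diverges (u : ℕ → Letter) (p q L : ℕ) (b : Bool) (ℓ : ℕ) : Prop where
  left : u p ≠ u q
  pos : 1 ≤ L
  common : ∀ i < L, u (p + 1 + i) = u (q + 1 + i)
  right_fst : u (p + 1 + L) = (b, ℓ + 1)
  right_snd : u (q + 1 + L) = (!b, 0)

namespace Diverges

variable {k : ℕ} {u : ℕ → Letter} {P : ℕ → ℕ} {p q L ℓ : ℕ} {b : Bool}

theorem seg_eq (h : Diverges u p q L b ℓ) : seg u (p + 1) L = seg u (q + 1) L := by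
  simp only [seg, List.map_inj_left, List.mem_range]
  exact h.common

theorem last_fst (h : Diverges u p q L b ℓ) (hd : Desubstitutes k u P) (hk : 4 ≤ k) :
    u (p + L) = (b, ℓ) :=
  hd.pred_letter hk (by rw [← h.right_fst]; congr 1; omega)

theorem last_snd (h : Diverges u p q L b ℓ) (hd : Desubstitutes k u P) (hk : 4 ≤ k) :
    u (q + L) = (b, ℓ) := by
  have h1 := h.pos
  have h2 := h.common (L - 1) (by omega)
  rw [show p + 1 + (L - 1) = p + L by omega, show q + 1 + (L - 1) = q + L by omega] at h2
  rw [← h2, h.last_fst hd hk]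

theorem desubstitute_succ (h : Diverges u p q L b (ℓ + 1)) (hd : Desubstitutes k u P)
    (hk : 4 ≤ k) : ∃ p' q' L', Diverges u p' q' L' b ℓ ∧
      seg u (p + 1) L = xiW k (seg u (p' + 1) L') ∧
      (u (p + 2 + L) = (b, 0) → u (p' + 2 + L') = (b, 0)) := by
  have hpos := h.pos
  have hlp := h.last_fst hd hk
  have hlq := h.last_snd hd hk
  have hL : 2 ≤ L := by
    by_contra hc
    obtain rfl : L = 1 := by omega
    exact h.left ((hd.pred_letter hk hlp).trans (hd.pred_letter hk hlq).symm)
  obtain ⟨p', q', hp, hq, hne⟩ := hd.exists_preimage_of_left_ne hk h.left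
    (h.common 0 (by omega)) (h.common 1 (by omega))
  obtain ⟨m, hm, hmb, -, hm1⟩ := hd.exists_preimage_add_two hk h.right_fst
  obtain ⟨l, hl, hlb⟩ := hd.exists_preimage_zero hk h.right_snd
  obtain ⟨L', rfl, rfl, hc⟩ := hd.exists_preimage_common hk (p := p' + 1) (q := q' + 1) L
    (by rw [hp, hq]; exact h.common) (hm.trans (by rw [hp])) (hl.trans (by rw [hq]))
  have hL' : 1 ≤ L' := by
    by_contra h0
    obtain rfl : L' = 0 := by omega
    rw [add_zero] at hm; omega
  have hlast := hd.pred_letter hk (n := p' + L') (by rw [← hmb]; congr 1; omega)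
  refine ⟨p', q', L', ⟨hne, hL', hc, hmb, ?_⟩, ?_, fun h0 => ?_⟩
  · rcases hlb with hlb | ⟨hlb, -⟩
    · exact hlb.1
    · exfalso
      have hcl := hc (L' - 1) (by omega)
      rw [show p' + 1 + (L' - 1) = p' + L' by omega,
        show q' + 1 + (L' - 1) = q' + L' by omega, hlast] at hcl
      obtain ⟨i, rfl⟩ : ∃ i, k = i + 2 := ⟨k - 2, by omega⟩
      have h3 : u (q' + L' + 1) = (b, i + 1) := by
        rw [show q' + L' + 1 = q' + 1 + L' by omega, hlb]; simp
      have h4 := hd.pred_letter hk h3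
      rw [← hcl] at h4
      simp only [Prod.mk.injEq] at h4
      have := hd.snd_lt hk (p + 1 + L)
      rw [h.right_fst] at this
      simp only at this
      omega
  · rw [← hp]; exact hd.seg_image _ (by rw [hp]; exact hm)
  · obtain ⟨r, hr, hrb⟩ := hd.exists_preimage_zero hk h0
    obtain rfl : r = p' + 2 + L' := hd.strictMono.injective (by
      rw [hr, show p' + 2 + L' = p' + 1 + L' + 1 by omega, hm1]; omega)
    rcases hrb with hrb | ⟨hrb, -⟩
    · exact hrb.1
    · exfalso
      obtain ⟨i, rfl⟩ : ∃ i, k = i + 2 := ⟨k - 2, by omega⟩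
      have := hd.pred_letter hk (n := p' + 1 + L') (b := !b) (j := i)
        (by rw [show p' + 1 + L' + 1 = p' + 2 + L' by omega, hrb]; simp)
      rw [hmb] at this
      simp at this

theorem desubstitute_zero (h : Diverges u p q L b 0) (hd : Desubstitutes k u P)
    (hk : 4 ≤ k) (hL : 2 ≤ L) : ∃ p' q' L', Diverges u q' p' L' (!b) (k - 2) ∧
      seg u (p + 1) L = xiW k (seg u (q' + 1) L') ++ [(b, 0)] ∧
      u (q' + 2 + L') = (!b, 0) := by
  have hlp := h.last_fst hd hk
  have hlq := h.last_snd hd hk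
  obtain ⟨p', q', hp, hq, hne⟩ := hd.exists_preimage_of_left_ne hk h.left
    (h.common 0 (by omega)) (h.common 1 (by omega))
  obtain ⟨m, hm, hmb⟩ := hd.exists_preimage_zero_one hk (c := b) hlp
    (by rw [← h.right_fst]; congr 1; omega)
  obtain ⟨l, hl, hlb, -, hl1, -⟩ := hd.of_zero_zero hk (c := !b) hlq
    (by rw [← h.right_snd]; congr 1; omega)
  obtain ⟨L', rfl, rfl, hc⟩ := hd.exists_preimage_common hk (p := p' + 1) (q := q' + 1) (L - 1)
    (fun i hi => by rw [hp, hq]; exact h.common i (by omega)) (hm.trans (by rw [hp]; omega))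
    (hl.trans (by rw [hq]; omega))
  have hL' : 1 ≤ L' := by
    by_contra h0
    obtain rfl : L' = 0 := by omega
    rw [add_zero] at hm; omega
  have hD : Diverges u q' p' L' (!b) (k - 2) :=
    ⟨hne.symm, hL', fun i hi => (hc i hi).symm,
      by rw [hlb, show k - 2 + 1 = k - 1 by omega], by simpa using hmb⟩
  refine ⟨p', q', L', hD, ?_, ?_⟩
  · rw [hD.seg_eq, ← hd.seg_image (p' + 1) (L := L - 1) (by rw [hm, hp]; omega), hp]
    obtain ⟨n, rfl⟩ : ∃ n, L = n + 1 := ⟨L - 1, by omega⟩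
    rw [seg_add, Nat.add_sub_cancel, ← hlp]
    simp [seg, add_assoc, add_comm 1 n]
  · rw [← hl1]; congr 1; omega

theorem seg_eq_of_next_zero (h : Diverges u p q L b ℓ) (hd : Desubstitutes k u P)
    (hk : 4 ≤ k) (h0 : u (p + 2 + L) = (b, 0)) :
    seg u (p + 1) L = (xiW k)^[ℓ] [(b, 0)] := by
  induction ℓ generalizing p q L with
  | zero =>
    have hlp := h.last_fst hd hk
    have hlq := h.last_snd hd hk
    have hpos := h.pos
    obtain ⟨n, rfl⟩ : ∃ n, L = n + 1 := ⟨L - 1, by omega⟩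
    rcases n with _ | n
    · simpa [seg] using hlp
    · exfalso
      have hq1 := hd.pred_of_zero_zero hk (n := q + (n + 1)) (c := !b) hlq
        (by rw [← h.right_snd]; congr 1; omega)
      have hc := h.common n (by omega)
      rw [show q + 1 + n = q + (n + 1) by omega, hq1] at hc
      obtain ⟨i, rfl⟩ : ∃ i, k = i + 2 := ⟨k - 2, by omega⟩
      have hr := h.right_fst
      rcases hd.after_nonzero_zero hk (n := p + 1 + n) (b := !b) (j := i) (c := b)
        (by rw [hc]; simp) (by rw [← hlp]; congr 1; omega) with ⟨-, h2⟩ | ⟨⟨d, h2⟩, -, -⟩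
      · rw [show p + 1 + n + 3 = p + 2 + (n + 1 + 1) by omega, h0] at h2
        simp at h2
      · rw [show p + 1 + n + 2 = p + 1 + (n + 1 + 1) by omega, hr] at h2
        simp at h2
  | succ ℓ ih =>
    obtain ⟨p', q', L', h', hs, h1⟩ := h.desubstitute_succ hd hk
    rw [hs, ih h' (h1 h0), Function.iterate_succ_apply']

theorem exists_seg_eq (h : Diverges u p q L b ℓ) (hd : Desubstitutes k u P) (hk : 4 ≤ k) :
    ∃ n c, n ≤ k + ℓ ∧ seg u (p + 1) L = (xiW k)^[n] [(c, 0)] := by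
  induction ℓ generalizing p q L with
  | zero =>
    by_cases hL : 2 ≤ L
    · obtain ⟨p', q', L', h', hs, h1⟩ := h.desubstitute_zero hd hk hL
      refine ⟨k, !b, le_rfl, ?_⟩
      rw [hs, h'.seg_eq_of_next_zero hd hk h1, ← xiW_iterate_zero_append hk,
        ← Function.iterate_succ_apply' (xiW k), show (k - 2).succ = k - 1 by omega, Bool.not_not]
    · obtain rfl : L = 1 := by have := h.pos; omega
      exact ⟨0, b, by omega, by simpa [seg] using h.last_fst hd hk⟩
  | succ ℓ ih =>
    obtain ⟨p', q', L', h', hs, -⟩ := h.desubstitute_succ hd hk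
    obtain ⟨n, c, hn, hc⟩ := ih h'
    exact ⟨n + 1, c, by omega, by rw [hs, hc, Function.iterate_succ_apply']⟩

theorem length_le (h : Diverges u p q L b ℓ) (hd : Desubstitutes k u P) (hk : 4 ≤ k) :
    L ≤ (xiPow k (2 * k - 2)).length := by
  obtain ⟨n, c, hn, hc⟩ := h.exists_seg_eq hd hk
  have := hd.snd_lt hk (p + 1 + L)
  rw [h.right_fst] at this
  simp only at this
  rw [← seg_length u (p + 1) L, hc, length_xiW_iterate_zero]
  exact xiPow_length_mono k (show n ≤ 2 * k - 2 by omega)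

theorem proj_ne (h : Diverges u p q L b ℓ) (hd : Desubstitutes k u P) (hk : 4 ≤ k)
    (h1 : proj (u (p + 2 + L)) = proj (u (q + 2 + L))) :
    proj (u (p + 3 + L)) ≠ proj (u (q + 3 + L)) := by
  have hlq := h.last_snd hd hk
  have hrp : u (p + L + 1) = (b, ℓ + 1) := by rw [← h.right_fst]; congr 1; omega
  have hrq : u (q + L + 1) = (!b, 0) := by rw [← h.right_snd]; congr 1; omega
  have hlt := hd.snd_lt hk (p + L + 1)
  rw [hrp] at hlt
  simp only at hlt
  rw [show p + 2 + L = p + L + 2 by omega, show q + 2 + L = q + L + 2 by omega] at h1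
  rw [show p + 3 + L = p + L + 3 by omega, show q + 3 + L = q + L + 3 by omega]
  have hq : u (q + L + 2) = (!b, 1) ∧ u (q + L + 3) = (!b, 2) := by
    rcases ℓ with _ | ℓ
    · obtain ⟨h2, h3⟩ := hd.after_zero_zero hk hlq hrq
      exact ⟨h2, h3.resolve_left (by simp)⟩
    · exact (hd.after_nonzero_zero hk hlq hrq).resolve_right fun h2 => by omega
  rw [hq.1] at h1
  rw [hq.2]
  rcases hd.next_letter hk hrp with ⟨h2, -⟩ | ⟨c, h2⟩
  · rw [h2] at h1
    simp [proj] at h1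
  · rw [h2] at h1
    simp only [proj, if_true, one_ne_zero, if_false, Bool.not_not] at h1
    subst h1
    rcases hd.after_nonzero_zero hk hrp h2 with ⟨h3, -⟩ | ⟨-, -, h3⟩
    · rw [show p + L + 3 = p + L + 1 + 2 by omega, h3]
      simp [proj]
    · simp at h3

end Diverges

theorem proj_zero (b : Bool) : proj (b, 0) = b := rfl

theorem proj_add_one (b : Bool) (j : ℕ) : proj (b, j + 1) = !b := by simp [proj]

theorem proj_twin (a : Letter) : proj (twin a) = !proj a := by
  unfold proj twin; split_ifs <;> simp

namespace Desubstitutes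

variable {k : ℕ} {u : ℕ → Letter} {P : ℕ → ℕ}

theorem exists_first_zero (hd : Desubstitutes k u P) (hk : 4 ≤ k) (p : ℕ) :
    ∃ a ≤ k - 1, ∃ c, (∃ d, u (p + a) = (d, 0)) ∧ ∀ i < a, ∃ j, u (p + i) = (c, j + 1) := by
  have key : ∀ r p c j, u p = (c, j + 1) → k - 1 - j = r →
      ∃ a ≤ r, (∃ d, u (p + a) = (d, 0)) ∧ ∀ i < a, ∃ j, u (p + i) = (c, j + 1) := by
    intro r
    induction r with
    | zero =>
      intro p c j hp hj
      have := hd.snd_lt hk p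
      rw [hp] at this
      simp only at this
      omega
    | succ r ih =>
      intro p c j hp hj
      rcases hd.next_letter hk hp with ⟨h1, -⟩ | h1
      · obtain ⟨a, har, hz, hnz⟩ := ih (p + 1) c (j + 1) h1 (by omega)
        refine ⟨a + 1, by omega, by rwa [show p + (a + 1) = p + 1 + a by omega], ?_⟩
        rintro (_ | i) hi
        · exact ⟨j, hp⟩
        · rw [show p + (i + 1) = p + 1 + i by omega]
          exact hnz i (by omega)
      · refine ⟨1, by omega, h1, fun i hi => ?_⟩
        obtain rfl : i = 0 := by omega
        exact ⟨j, hp⟩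
  rcases hp : u p with ⟨c, _ | j⟩
  · exact ⟨0, by omega, c, ⟨c, hp⟩, by simp⟩
  · obtain ⟨a, ha, h1, h2⟩ := key _ p c j hp rfl
    exact ⟨a, by omega, c, h1, h2⟩

/-- Two factors of `u` with the same projection synchronize at the later one of their first zero
letters. -/
theorem eq_of_proj_eq (hd : Desubstitutes k u P) (hk : 4 ≤ k) {p q N a b : ℕ} {c : Bool}
    (hN : k + 5 ≤ N) (hπ : ∀ i < N, proj (u (p + i)) = proj (u (q + i)))
    (hp : ∀ i < a, ∃ j, u (p + i) = (c, j + 1)) (ha : ∃ d, u (p + a) = (d, 0))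
    (hak : a ≤ k - 1) (hb : ∃ d, u (q + b) = (d, 0)) (hba : b ≤ a) :
    u (p + a) = u (q + a) := by
  have hzero : ∀ i < N, (∃ d, u (p + i) = (d, 0)) → (∃ d, u (q + i) = (d, 0)) →
      u (p + i) = u (q + i) := by
    rintro i hi ⟨d, hd1⟩ ⟨e, he⟩
    have := hπ i hi
    rw [hd1, he, proj_zero, proj_zero] at this
    rw [hd1, he, this]
  have hpre : ∀ i < a, proj (u (q + i)) = !c := by
    intro i hi
    obtain ⟨j, hj⟩ := hp i hi
    rw [← hπ i (by omega), hj, proj_add_one]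
  rcases Nat.eq_or_lt_of_le hba with rfl | hlt
  · exact hzero _ (by omega) ha hb
  obtain ⟨d, hb⟩ := hb
  obtain rfl : d = !c := by simpa [hb, proj_zero] using hpre b hlt
  by_cases hz : ∃ e, u (q + a) = (e, 0)
  · exact hzero _ (by omega) ha hz
  exfalso
  have hone : u (q + a) = (!c, 1) := by
    rcases hd.next_letter hk hb with ⟨h1, -⟩ | ⟨e, h1⟩
    · rcases Nat.eq_or_lt_of_le hlt with rfl | hlt2
      · exact h1
      · have := hpre (b + 1) hlt2
        rw [← add_assoc, h1] at this
        simp [proj] at this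
    · rcases Nat.eq_or_lt_of_le hlt with rfl | hlt2
      · exact absurd ⟨e, h1⟩ hz
      · have he := hpre (b + 1) hlt2
        rw [← add_assoc, h1, proj_zero] at he
        subst he
        have h2 := (hd.after_zero_zero hk hb h1).1
        rcases Nat.eq_or_lt_of_le hlt2 with rfl | hlt3
        · exact h2
        · have := hpre (b + 2) hlt3
          rw [← add_assoc, h2] at this
          simp [proj] at this
  obtain ⟨d, ha⟩ := ha
  obtain rfl : d = c := by
    have := hπ a (by omega)
    rw [ha, hone] at this
    simpa [proj] using this
  obtain ⟨a, rfl⟩ : ∃ a', a = a' + 1 := ⟨a - 1, by omega⟩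
  obtain ⟨j, hj⟩ := hp a (by omega)
  obtain ⟨h1, h2⟩ := (hd.after_nonzero_zero hk hj ha).resolve_right (by simp)
  have e1 := hπ (a + 2) (by omega)
  have e2 := hπ (a + 3) (by omega)
  rw [← add_assoc, ← add_assoc, h1] at e1
  rw [← add_assoc, ← add_assoc, h2] at e2
  rcases hd.next_letter hk hone with ⟨h3, -⟩ | ⟨e, h3⟩
  · rw [show q + (a + 1) + 1 = q + a + 2 by omega] at h3
    rw [h3] at e1
    simp [proj] at e1
  · have h4 := ((hd.after_nonzero_zero hk hone h3).resolve_right (by omega)).1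
    rw [show q + (a + 1) + 1 = q + a + 2 by omega] at h3
    rw [show q + (a + 1) + 2 = q + a + 3 by omega] at h4
    rw [h3] at e1
    rw [h4] at e2
    simp only [proj, if_true, one_ne_zero, if_false, OfNat.ofNat_ne_zero] at e1 e2
    subst e1
    simp at e2

theorem exists_sync (hd : Desubstitutes k u P) (hk : 4 ≤ k) {p q N : ℕ} (hN : k + 5 ≤ N)
    (hπ : ∀ i < N, proj (u (p + i)) = proj (u (q + i))) :
    ∃ s ≤ k - 1, ∃ c, u (p + s) = u (q + s) ∧ ∀ i < s, proj (u (p + i)) = c := by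
  obtain ⟨a, ha, c, hz, hnz⟩ := hd.exists_first_zero hk p
  obtain ⟨b, hb, d, hz', hnz'⟩ := hd.exists_first_zero hk q
  rcases le_total b a with h | h
  · refine ⟨a, ha, !c, hd.eq_of_proj_eq hk hN hπ hnz hz ha hz' h, fun i hi => ?_⟩
    obtain ⟨j, hj⟩ := hnz i hi
    rw [hj, proj_add_one]
  · refine ⟨b, hb, !d, (hd.eq_of_proj_eq hk hN (fun i hi => (hπ i hi).symm) hnz' hz' hb hz h).symm,
      fun i hi => ?_⟩
    obtain ⟨j, hj⟩ := hnz' i hi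
    rw [hπ i (by omega), hj, proj_add_one]

/-- Two distinct letters with the same projection that follow the same letter are the next letter
and the zero letter of the opposite sign. -/
theorem next_of_proj_eq (hd : Desubstitutes k u P) (hk : 4 ≤ k) {p q : ℕ} (h : u p = u q)
    (h1 : u (p + 1) ≠ u (q + 1)) (hπ : proj (u (p + 1)) = proj (u (q + 1))) :
    ∃ b ℓ, u (p + 1) = (b, ℓ + 1) ∧ u (q + 1) = (!b, 0) ∨
      u (q + 1) = (b, ℓ + 1) ∧ u (p + 1) = (!b, 0) := by
  rcases hp : u p with ⟨b, ℓ⟩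
  have hq := hp
  rw [h] at hq
  refine ⟨b, ℓ, ?_⟩
  rcases hd.next_letter hk hp with ⟨h2, -⟩ | ⟨c, h2⟩ <;>
  rcases hd.next_letter hk hq with ⟨h3, -⟩ | ⟨d, h3⟩ <;>
  rw [h2, h3] at h1 hπ ⊢ <;> simp_all [proj]

/-- Two long factors of `u` with the same projection that are preceded by letters with distinct
projections agree up to a short prefix whose projection is constant. -/
theorem eq_after_prefix (hd : Desubstitutes k u P) (hk : 4 ≤ k) {p q N : ℕ}
    (hN : (xiPow k (2 * k - 2)).length + k + 2 ≤ N) (h0 : u p ≠ u q)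
    (hπ : ∀ i < N, proj (u (p + 1 + i)) = proj (u (q + 1 + i))) :
    ∃ s ≤ k - 1, ∃ c, (∀ i < s, proj (u (p + 1 + i)) = c) ∧ u (p + s) ≠ u (q + s) ∧
      ∀ i < N, s ≤ i → u (p + 1 + i) = u (q + 1 + i) := by
  classical
  have hNk : k + 5 ≤ N := by
    obtain ⟨t, ht, hl⟩ := xiPow_eq_cons k (2 * k - 2)
    rw [ht, List.length_cons] at hN
    omega
  obtain ⟨s₀, hs₀, c, heq, hc⟩ := hd.exists_sync hk hNk hπ
  have hex : ∃ s, s ≤ s₀ ∧ ∀ i ≤ s₀, s ≤ i → u (p + 1 + i) = u (q + 1 + i) :=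
    ⟨s₀, le_rfl, fun i hi hi' => by rwa [le_antisymm hi hi']⟩
  obtain ⟨hs, hagree⟩ := Nat.find_spec hex
  have hmin : ∀ t < Nat.find hex, _ := fun t ht => Nat.find_min hex ht
  generalize Nat.find hex = s at hs hagree hmin
  have hleft : u (p + s) ≠ u (q + s) := by
    rcases s with _ | s
    · exact h0
    · intro h
      refine hmin s (by omega) ⟨by omega, fun i hi hsi => ?_⟩
      rcases Nat.eq_or_lt_of_le hsi with rfl | hlt
      · rwa [show p + 1 + s = p + (s + 1) by omega, show q + 1 + s = q + (s + 1) by omega]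
      · exact hagree i hi hlt
  refine ⟨s, by omega, c, fun i hi => hc i (by omega), hleft, ?_⟩
  by_contra hcon
  push Not at hcon
  obtain ⟨heN, hse, hne⟩ := Nat.find_spec hcon
  have hmin' : ∀ t < Nat.find hcon, _ := fun t ht => Nat.find_min hcon ht
  generalize Nat.find hcon = e at heN hse hne hmin'
  have hse' : s < e := by
    rcases Nat.eq_or_lt_of_le hse with rfl | h
    · exact absurd (hagree s hs le_rfl) hne
    · exact h
  have hcommon : ∀ i < e - s, u (p + s + 1 + i) = u (q + s + 1 + i) := by
    intro i hi
    by_contra h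
    refine hmin' (s + i) (by omega) ⟨by omega, by omega, ?_⟩
    rwa [show p + 1 + (s + i) = p + s + 1 + i by omega,
      show q + 1 + (s + i) = q + s + 1 + i by omega]
  have hlast := hcommon (e - s - 1) (by omega)
  rw [show p + s + 1 + (e - s - 1) = p + e by omega,
    show q + s + 1 + (e - s - 1) = q + e by omega] at hlast
  have hπe := hπ e heN
  rw [show p + 1 + e = p + e + 1 by omega, show q + 1 + e = q + e + 1 by omega] at hne hπe
  have hlen : e - s ≤ (xiPow k (2 * k - 2)).length ∧
      (e + 2 < N → proj (u (p + 2 + e)) = proj (u (q + 2 + e)) →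
        proj (u (p + 3 + e)) ≠ proj (u (q + 3 + e))) := by
    obtain ⟨b, ℓ, ⟨h1, h2⟩ | ⟨h1, h2⟩⟩ := hd.next_of_proj_eq hk hlast hne hπe
    · have hD : Diverges u (p + s) (q + s) (e - s) b ℓ :=
        ⟨hleft, by omega, hcommon, by rw [← h1]; congr 1; omega, by rw [← h2]; congr 1; omega⟩
      have := hD.proj_ne hd hk
      rw [show p + s + 2 + (e - s) = p + 2 + e by omega,
        show q + s + 2 + (e - s) = q + 2 + e by omega,
        show p + s + 3 + (e - s) = p + 3 + e by omega,
        show q + s + 3 + (e - s) = q + 3 + e by omega] at this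
      exact ⟨hD.length_le hd hk, fun _ => this⟩
    · have hD : Diverges u (q + s) (p + s) (e - s) b ℓ :=
        ⟨hleft.symm, by omega, fun i hi => (hcommon i hi).symm,
          by rw [← h1]; congr 1; omega, by rw [← h2]; congr 1; omega⟩
      have := hD.proj_ne hd hk
      rw [show p + s + 2 + (e - s) = p + 2 + e by omega,
        show q + s + 2 + (e - s) = q + 2 + e by omega,
        show p + s + 3 + (e - s) = p + 3 + e by omega,
        show q + s + 3 + (e - s) = q + 3 + e by omega] at this
      exact ⟨hD.length_le hd hk, fun _ h => (this h.symm).symm⟩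
  have hπ1 := hπ (e + 1) (by omega)
  have hπ2 := hπ (e + 2) (by omega)
  rw [show p + 1 + (e + 1) = p + 2 + e by omega,
    show q + 1 + (e + 1) = q + 2 + e by omega] at hπ1
  rw [show p + 1 + (e + 2) = p + 3 + e by omega,
    show q + 1 + (e + 2) = q + 3 + e by omega] at hπ2
  exact hlen.2 (by omega) hπ1 hπ2

end Desubstitutes

theorem seg_eq_replicate {α : Type*} {v : ℕ → α} {p s : ℕ} {c : α}
    (h : ∀ i < s, v (p + i) = c) : seg v p s = List.replicate s c := by
  rw [List.eq_replicate_iff]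
  refine ⟨seg_length _ _ _, fun b hb => ?_⟩
  simp only [seg, List.mem_map, List.mem_range] at hb
  obtain ⟨i, hi, rfl⟩ := hb
  exact h i hi

theorem cons_seg {α : Type*} (v : ℕ → α) (p L : ℕ) :
    v p :: seg v (p + 1) L = seg v p (1 + L) := by
  rw [seg_add]; simp [seg]

theorem eq_of_occursAt_cons {α : Type*} {a : α} {w : List α} {v : ℕ → α} {p : ℕ}
    (h : OccursAt (a :: w) v p) : v p = a ∧ w = seg v (p + 1) w.length := by
  rw [occursAt_iff_seg, List.length_cons, add_comm w.length 1, ← cons_seg, List.cons.injEq] at h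
  exact ⟨h.1.symm, h.2⟩

/-- for `k ≥ 4`, every left special factor `w` of `x_k = π(u_k)` with
`|w| ≥ |ξ^{2k−2}(0)| + k + 2` is, up to the twin map (exchange `0 ↔ 1`), of the form
`0^{i−1}π(f)` for some `1 ≤ i ≤ k` and some left special factor `f` of `u_k`. -/
theorem stmt_16 (k : ℕ) (hk : 4 ≤ k) (u : ℕ → Letter) (hu : IsFixedPoint k u)
    (x : ℕ → Bool) (hx : x = fun n => proj (u n))
    (w : List Bool) (hw : LeftSpecial w x)
    (hlen : (xiPow k (2 * k - 2)).length + k + 2 ≤ w.length) :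
    ∃ (i : ℕ) (f : List Letter), 1 ≤ i ∧ i ≤ k ∧ LeftSpecial f u ∧
      (w = List.replicate (i - 1) false ++ f.map proj ∨
       w.map (fun b => !b) = List.replicate (i - 1) false ++ f.map proj) := by
  subst hx
  obtain ⟨P, hd⟩ := hu.desubstitutes
  obtain ⟨a, b, hab, ⟨p, hp⟩, ⟨q, hq⟩⟩ := hw
  obtain ⟨hpa, hpw⟩ := eq_of_occursAt_cons hp
  obtain ⟨hqb, hqw⟩ := eq_of_occursAt_cons hq
  have hπ : ∀ i < w.length, proj (u (p + 1 + i)) = proj (u (q + 1 + i)) := by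
    intro i hi
    have := hpw.symm.trans hqw
    simp only [seg, List.map_inj_left, List.mem_range] at this
    exact this i hi
  have hne : u p ≠ u q := fun h => hab (by rw [← hpa, ← hqb, h])
  obtain ⟨s, hs, c, hc, hleft, hright⟩ := hd.eq_after_prefix hk hlen hne hπ
  obtain ⟨n, hn⟩ : ∃ n, w.length = s + n := ⟨w.length - s, by omega⟩
  have hf : LeftSpecial (seg u (p + 1 + s) n) u := by
    have hpq : seg u (p + 1 + s) n = seg u (q + 1 + s) n := by
      simp only [seg, List.map_inj_left, List.mem_range]
      intro i hi
      rw [add_assoc (p + 1), add_assoc (q + 1)]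
      exact hright (s + i) (by omega) (by omega)
    refine ⟨u (p + s), u (q + s), hleft, ⟨p + s, ?_⟩, ⟨q + s, ?_⟩⟩
    · rw [show p + 1 + s = p + s + 1 by omega, cons_seg]
      exact occursAt_seg _ _ _
    · rw [hpq, show q + 1 + s = q + s + 1 by omega, cons_seg]
      exact occursAt_seg _ _ _
  have hwf : w = List.replicate s c ++ (seg u (p + 1 + s) n).map proj := by
    rw [hpw, hn, seg_add, seg_eq_replicate hc]
    simp [seg]
  cases c with
  | false => exact ⟨s + 1, _, by omega, by omega, hf, Or.inl hwf⟩
  | true =>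
    refine ⟨s + 1, _, by omega, by omega, hu.leftSpecial_map_twin hk hf, Or.inr ?_⟩
    rw [hwf]
    simp [Function.comp_def, proj_twin]
end
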